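/- Let M, N, K be positive integers, P ∈ ℝ^{M×K}, Q ∈ ℝ^{K×N}, λ₀ > 0 and c₂ ≥ 0. Define F(U,Z) = (λ₀/2)‖U‖_F² + ⟨P,U⟩_F + ⟨Q,Z⟩_F + 3·((‖U‖_F² + ‖Z‖_F²)/2)² + c₂·(‖U‖_F² + ‖Z‖_F²)/2 on ℝ^{M×K} × ℝ^{K×N}. If r₁ > 0 satisfies the fifth-order equation 3·(‖P‖_F²·r₁² + ‖Q‖_F²·(r₁+λ₀)²) + c₂·r₁²·(r₁+λ₀)² − r₁³·(r₁+λ₀)² = 0, then (U*, Z*) = (−P/(r₁+λ₀), −Q/r₁) is a global minimizer of F. -/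

import Mathlib

/-- Frobenius inner product of real matrices. -/
noncomputable def fip {m n : ℕ} (X Y : Matrix (Fin m) (Fin n) ℝ) : ℝ :=
  ∑ i, ∑ j, X i j * Y i j

/-- Frobenius norm of a real matrix. -/
noncomputable def fnorm {m n : ℕ} (X : Matrix (Fin m) (Fin n) ℝ) : ℝ :=
  Real.sqrt (fip X X)

theorem fip_self_nonneg {m n : ℕ} (X : Matrix (Fin m) (Fin n) ℝ) : 0 ≤ fip X X :=
  Finset.sum_nonneg fun _ _ => Finset.sum_nonneg fun _ _ => mul_self_nonneg _

theorem fnorm_sq {m n : ℕ} (X : Matrix (Fin m) (Fin n) ℝ) : fnorm X ^ 2 = fip X X :=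
  Real.sq_sqrt (fip_self_nonneg X)

theorem fip_neg_smul_right {m n : ℕ} (X Y : Matrix (Fin m) (Fin n) ℝ) (t : ℝ) :
    fip X (-(t • Y)) = -(t * fip X Y) := by
  simp only [fip, Finset.mul_sum, ← Finset.sum_neg_distrib, Matrix.neg_apply,
    Matrix.smul_apply, smul_eq_mul]
  exact Finset.sum_congr rfl fun _ _ => Finset.sum_congr rfl fun _ _ => by ring

theorem fip_comm {m n : ℕ} (X Y : Matrix (Fin m) (Fin n) ℝ) : fip X Y = fip Y X := by
  simp only [fip, mul_comm]

theorem fip_add_smul_self {m n : ℕ} (X Y : Matrix (Fin m) (Fin n) ℝ) (t : ℝ) :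
    fip (X + t • Y) (X + t • Y) = fip X X + 2 * t * fip Y X + t ^ 2 * fip Y Y := by
  simp only [fip, Finset.mul_sum, ← Finset.sum_add_distrib, Matrix.add_apply,
    Matrix.smul_apply, smul_eq_mul]
  exact Finset.sum_congr rfl fun _ _ => Finset.sum_congr rfl fun _ _ => by ring

/-- if r₁ > 0 solves the fifth-order equation
3(‖P‖²r₁² + ‖Q‖²(r₁+λ₀)²) + c₂ r₁²(r₁+λ₀)² − r₁³(r₁+λ₀)² = 0, then
(U*,Z*) = (−P/(r₁+λ₀), −Q/r₁) globally minimizes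
F(U,Z) = (λ₀/2)‖U‖² + ⟨P,U⟩ + ⟨Q,Z⟩ + 3((‖U‖²+‖Z‖²)/2)² + c₂(‖U‖²+‖Z‖²)/2. -/
theorem stmt19 (M N K : ℕ) (hM : 0 < M) (hN : 0 < N) (hK : 0 < K)
    (P : Matrix (Fin M) (Fin K) ℝ) (Q : Matrix (Fin K) (Fin N) ℝ)
    (lam₀ c₂ : ℝ) (hlam₀ : 0 < lam₀) (hc₂ : 0 ≤ c₂)
    (r₁ : ℝ) (hr₁ : 0 < r₁)
    (hquintic : 3 * (fnorm P ^ 2 * r₁ ^ 2 + fnorm Q ^ 2 * (r₁ + lam₀) ^ 2) +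
      c₂ * r₁ ^ 2 * (r₁ + lam₀) ^ 2 - r₁ ^ 3 * (r₁ + lam₀) ^ 2 = 0) :
    ∀ (U : Matrix (Fin M) (Fin K) ℝ) (Z : Matrix (Fin K) (Fin N) ℝ),
      (lam₀ / 2) * fnorm (-((r₁ + lam₀)⁻¹ • P)) ^ 2 +
          fip P (-((r₁ + lam₀)⁻¹ • P)) + fip Q (-(r₁⁻¹ • Q)) +
          3 * ((fnorm (-((r₁ + lam₀)⁻¹ • P)) ^ 2 + fnorm (-(r₁⁻¹ • Q)) ^ 2) / 2) ^ 2 +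
          c₂ * ((fnorm (-((r₁ + lam₀)⁻¹ • P)) ^ 2 + fnorm (-(r₁⁻¹ • Q)) ^ 2) / 2) ≤
        (lam₀ / 2) * fnorm U ^ 2 + fip P U + fip Q Z +
          3 * ((fnorm U ^ 2 + fnorm Z ^ 2) / 2) ^ 2 +
          c₂ * ((fnorm U ^ 2 + fnorm Z ^ 2) / 2) := by
  intro U Z
  have ha : 0 < r₁ + lam₀ := by positivity
  have hU := fip_add_smul_self U P (r₁ + lam₀)⁻¹
  have hZ := fip_add_smul_self Z Q r₁⁻¹
  have hU0 := fip_self_nonneg (U + (r₁ + lam₀)⁻¹ • P)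
  have hZ0 := fip_self_nonneg (Z + r₁⁻¹ • Q)
  simp only [fnorm_sq, fip_neg_smul_right, fip_comm (-(_ • _)) _] at hquintic ⊢
  generalize fip (U + (r₁ + lam₀)⁻¹ • P) (U + (r₁ + lam₀)⁻¹ • P) = dU at hU hU0
  generalize fip (Z + r₁⁻¹ • Q) (Z + r₁⁻¹ • Q) = dZ at hZ hZ0
  generalize fip U U = u at *
  generalize fip Z Z = z at *
  generalize fip P U = pu at *
  generalize fip Q Z = qz at *
  generalize fip P P = p at *
  generalize fip Q Q = q at *
  obtain ⟨s, hs⟩ : ∃ s, s = p / (r₁ + lam₀) ^ 2 + q / r₁ ^ 2 := ⟨_, rfl⟩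
  have hc : c₂ = r₁ - 3 * s := by
    rw [hs]
    field_simp
    linear_combination hquintic
  have hpu : pu = (r₁ + lam₀) / 2 * (dU - u - p / (r₁ + lam₀) ^ 2) := by
    rw [hU]
    field_simp
    ring
  have hqz : qz = r₁ / 2 * (dZ - z - q / r₁ ^ 2) := by
    rw [hZ]
    field_simp
    ring
  have key : 0 ≤ (r₁ + lam₀) / 2 * dU + r₁ / 2 * dZ + 3 / 4 * (u + z - s) ^ 2 := by
    positivity
  rw [hpu, hqz, hc, ← sub_nonneg]
  refine key.trans_eq ?_
  rw [hs]
  field_simp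
  ring
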